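/- For a, b ∈ ℂ with 2b not a nonpositive integer and b+1/2 not a nonpositive integer, and real x with |x| < 1/3, the quadratic transformation holds: ₂F₁(a, b; 2b; 2x) = (1−x)^{−a} · ₂F₁(a/2, (a+1)/2; b+1/2; (x/(1−x))²). -/

import Mathlib

/-- The Pochhammer symbol `(a)_n = a(a+1)⋯(a+n-1)`. -/
noncomputable def poch (a : ℂ) (n : ℕ) : ℂ := Polynomial.eval a (ascPochhammer ℂ n)

/-- `z` is not a nonpositive integer. -/
def NotNonposInt (z : ℂ) : Prop := ∀ m : ℕ, z ≠ -(m : ℂ)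

/-- The Gauss hypergeometric series `₂F₁(a,b;c;x)`. -/
noncomputable def twoF1 (a b c x : ℂ) : ℂ :=
  ∑' k : ℕ, poch a k * poch b k / (poch c k * (Nat.factorial k)) * x ^ k

theorem poch_zero (a : ℂ) : poch a 0 = 1 := by simp [poch]

theorem poch_succ (a : ℂ) (n : ℕ) : poch a (n + 1) = poch a n * (a + n) :=
  ascPochhammer_succ_eval n a

theorem poch_add (a : ℂ) (m n : ℕ) : poch a (m + n) = poch a m * poch (a + m) n := by
  induction n with
  | zero => simp [poch_zero]
  | succ n ih =>
    rw [← add_assoc, poch_succ, ih, poch_succ]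
    push_cast
    ring

theorem NotNonposInt.add_natCast_ne_zero {z : ℂ} (hz : NotNonposInt z) (n : ℕ) : z + n ≠ 0 :=
  fun h => hz n (eq_neg_of_add_eq_zero_left h)

theorem NotNonposInt.poch_ne_zero {z : ℂ} (hz : NotNonposInt z) (n : ℕ) : poch z n ≠ 0 := by
  induction n with
  | zero => simp [poch_zero]
  | succ n ih => rw [poch_succ]; exact mul_ne_zero ih (hz.add_natCast_ne_zero n)

/-- The duplication formula for the Pochhammer symbol. -/
theorem poch_two_mul (a : ℂ) (k : ℕ) :
    poch a (2 * k) = 4 ^ k * (poch (a / 2) k * poch ((a + 1) / 2) k) := by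
  induction k with
  | zero => simp [poch_zero]
  | succ k ih =>
    rw [show 2 * (k + 1) = 2 * k + 1 + 1 by ring, poch_succ, poch_succ, ih, poch_succ, poch_succ]
    push_cast
    ring

theorem descFactorial_succ_cast (n k : ℕ) :
    ((n.descFactorial (k + 1) : ℕ) : ℂ) = (n - k) * n.descFactorial k := by
  rcases le_or_gt k n with h | h
  · rw [Nat.descFactorial_succ, Nat.cast_mul, Nat.cast_sub h]
  · rw [Nat.descFactorial_of_lt h, Nat.descFactorial_of_lt (h.trans k.lt_succ_self)]
    simp

/-- The weight of `n.descFactorial (2 * k)` in the finite sums below. -/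
noncomputable def quadWeight (c : ℂ) (k : ℕ) : ℂ := 1 / (4 ^ k * poch c k * (Nat.factorial k))

theorem quadWeight_succ {c : ℂ} (hc : NotNonposInt c) (k : ℕ) :
    quadWeight c k = 4 * (c + k) * (k + 1) * quadWeight c (k + 1) := by
  have h1 := hc.poch_ne_zero k
  have h2 := hc.add_natCast_ne_zero k
  have h3 : (Nat.factorial k : ℂ) ≠ 0 := by exact_mod_cast k.factorial_ne_zero
  have h4 : (k + 1 : ℂ) ≠ 0 := by exact_mod_cast k.succ_ne_zero
  rw [quadWeight, quadWeight, poch_succ, Nat.factorial_succ, pow_succ]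
  push_cast
  field_simp

/-- The telescoping certificate for the recurrence in `n` of
`∑ k, n.descFactorial (2 * k) * quadWeight (b + 1 / 2) k`. -/
theorem sum_range_quadWeight_telescope {b : ℂ} (hb : NotNonposInt (b + 1 / 2)) (n N : ℕ) :
    ∑ k ∈ Finset.range (N + 1),
      ((2 * b + n) * ((n + 1).descFactorial (2 * k) * quadWeight (b + 1 / 2) k) -
        2 * (b + n) * (n.descFactorial (2 * k) * quadWeight (b + 1 / 2) k)) =
      -(n.descFactorial (2 * N + 1) * quadWeight (b + 1 / 2) N) := by
  induction N with
  | zero => simp [quadWeight, poch_zero]; ring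
  | succ N ih =>
    rw [Finset.sum_range_succ, ih, quadWeight_succ hb N,
      show 2 * (N + 1) = 2 * N + 1 + 1 by ring, Nat.succ_descFactorial_succ,
      descFactorial_succ_cast n (2 * N + 1 + 1), descFactorial_succ_cast n (2 * N + 1)]
    push_cast
    ring

theorem hasSum_descFactorial_quadWeight {b : ℂ} (h2b : NotNonposInt (2 * b))
    (hb : NotNonposInt (b + 1 / 2)) (n : ℕ) :
    HasSum (fun k => (n.descFactorial (2 * k) : ℂ) * quadWeight (b + 1 / 2) k)
      (2 ^ n * poch b n / poch (2 * b) n) := by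
  have fin_sum : ∀ m N : ℕ, m ≤ N → HasSum
      (fun k => (m.descFactorial (2 * k) : ℂ) * quadWeight (b + 1 / 2) k)
      (∑ k ∈ Finset.range (N + 1), (m.descFactorial (2 * k) : ℂ) * quadWeight (b + 1 / 2) k) := by
    intro m N hm
    refine hasSum_sum_of_ne_finset_zero fun k hk => ?_
    rw [Finset.mem_range] at hk
    rw [Nat.descFactorial_of_lt (by omega)]
    simp
  induction n with
  | zero => simpa [poch_zero, quadWeight] using fin_sum 0 0 le_rfl
  | succ n ih =>
    have h0 := (fin_sum n (n + 1) n.le_succ).unique ih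
    have ht := sum_range_quadWeight_telescope hb n (n + 1)
    rw [Nat.descFactorial_of_lt (by omega : n < 2 * (n + 1) + 1), Finset.sum_sub_distrib,
      ← Finset.mul_sum, ← Finset.mul_sum, h0] at ht
    have h1 := h2b.poch_ne_zero n
    have h2 := h2b.add_natCast_ne_zero n
    convert fin_sum (n + 1) (n + 1) le_rfl using 1
    rw [poch_succ, poch_succ, pow_succ]
    field_simp at ht ⊢
    linear_combination -ht

/-- The binomial series in terms of the Pochhammer symbol. -/
theorem hasSum_poch_div_factorial (a : ℂ) {x : ℂ} (hx : ‖x‖ < 1) :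
    HasSum (fun n => poch a n / Nat.factorial n * x ^ n) ((1 - x) ^ (-a)) := by
  have h := (Complex.one_div_one_sub_cpow_hasFPowerSeriesOnBall_zero a).hasSum (y := x)
    (by simpa [enorm_eq_nnnorm] using! hx)
  rw [zero_add, one_div, ← Complex.cpow_neg] at h
  convert! h using 2 with n
  rw [FormalMultilinearSeries.ofScalars_apply_eq, smul_eq_mul, ← Ring.multichoose_eq]
  congr 1
  have hn : (Nat.factorial n : ℂ) ≠ 0 := by exact_mod_cast n.factorial_ne_zero
  rw [div_eq_iff hn, poch, ← Polynomial.ascPochhammer_smeval_eq_eval,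
    ← Ring.factorial_nsmul_multichoose_eq_ascPochhammer, nsmul_eq_mul, mul_comm]

theorem hasSum_poch_descFactorial (a : ℂ) {x : ℂ} (hx : ‖x‖ < 1) (m : ℕ) :
    HasSum (fun n => poch a n / Nat.factorial n * x ^ n * n.descFactorial m)
      (poch a m * (1 - x) ^ (-a) * (x / (1 - x)) ^ m) := by
  have hx1 : 1 - x ≠ 0 := by
    intro h
    rw [← sub_eq_zero.mp h] at hx
    simp at hx
  rw [← hasSum_nat_add_iff' m, Finset.sum_eq_zero, sub_zero]
  · convert! (hasSum_poch_div_factorial (a + m) hx).mul_left (poch a m * x ^ m) using 1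
    · ext n
      have hn : (Nat.factorial n : ℂ) ≠ 0 := by exact_mod_cast n.factorial_ne_zero
      have hnm : (Nat.factorial (n + m) : ℂ) ≠ 0 := by exact_mod_cast (n + m).factorial_ne_zero
      have hd : (Nat.factorial n : ℂ) * (n + m).descFactorial m = Nat.factorial (n + m) := by
        have := Nat.factorial_mul_descFactorial (Nat.le_add_left m n)
        rw [Nat.add_sub_cancel] at this
        exact_mod_cast this
      rw [add_comm n m, poch_add, add_comm m n, pow_add]
      field_simp
      linear_combination x ^ n * x ^ m * poch a m * poch (a + m) n * hd
    · rw [neg_add, ← sub_eq_add_neg, Complex.cpow_sub _ _ hx1, Complex.cpow_natCast, div_pow]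
      ring
  · intro n hn
    rw [Nat.descFactorial_of_lt (Finset.mem_range.mp hn)]
    simp

theorem norm_poch_le (a : ℂ) (n : ℕ) : ‖poch a n‖ ≤ (ascPochhammer ℝ n).eval (‖a‖ + 1) := by
  induction n with
  | zero => simp [poch_zero]
  | succ n ih =>
    rw [poch_succ, ascPochhammer_succ_eval, norm_mul]
    gcongr
    · exact (ascPochhammer_pos n _ (by positivity)).le
    · refine (norm_add_le _ _).trans ?_
      rw [Complex.norm_natCast]
      linarith

theorem poch_ofReal (α : ℝ) (n : ℕ) : poch α n = ((ascPochhammer ℝ n).eval α : ℝ) := by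
  induction n with
  | zero => simp [poch_zero]
  | succ n ih => rw [poch_succ, ascPochhammer_succ_eval, ih]; push_cast; ring

open Filter Topology in
theorem summable_poch_two_mul_quadWeight {α : ℝ} (hα : 0 < α) {c : ℂ} (hc : NotNonposInt c) :
    Summable fun k => poch α (2 * k) * (1 / 2) ^ (2 * k) * quadWeight c k := by
  have hα' : NotNonposInt (α : ℂ) := by
    intro m h
    have : α = -(m : ℝ) := by exact_mod_cast h
    have := m.cast_nonneg (α := ℝ)
    linarith
  have hw : ∀ k, quadWeight c k ≠ 0 := fun k => by
    have := hc.poch_ne_zero k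
    have : (Nat.factorial k : ℂ) ≠ 0 := by exact_mod_cast k.factorial_ne_zero
    unfold quadWeight
    simp_all
  refine summable_of_ratio_test_tendsto_lt_one (l := 1 / 4) (by norm_num)
    (Eventually.of_forall fun k => ?_) ?_
  · exact mul_ne_zero (mul_ne_zero (hα'.poch_ne_zero _) (pow_ne_zero _ (by norm_num))) (hw k)
  · have h1 := tendsto_add_mul_div_add_mul_atTop_nhds (α : ℂ) c 2 one_ne_zero
    have h2 := tendsto_add_mul_div_add_mul_atTop_nhds (α + 1 : ℂ) 1 2 one_ne_zero
    have h3 := ((h1.mul h2).const_mul (1 / 16)).norm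
    norm_num at h3
    norm_num
    refine h3.congr fun k => ?_
    rw [show 2 * (k + 1) = 2 * k + 1 + 1 by ring, poch_succ, poch_succ, quadWeight_succ hc k]
    have e1 := norm_ne_zero_iff.mpr (hα'.poch_ne_zero (2 * k))
    have e2 := norm_ne_zero_iff.mpr (hw (k + 1))
    have e3 := norm_ne_zero_iff.mpr (hc.add_natCast_ne_zero k)
    have e4 : ‖(1 + k : ℂ)‖ ≠ 0 := norm_ne_zero_iff.mpr (by exact_mod_cast (by omega : 1 + k ≠ 0))
    push_cast
    rw [add_comm (k : ℂ) 1, show (α + (2 * k + 1) : ℂ) = α + 1 + 2 * k by ring]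
    simp only [norm_mul, Complex.norm_ofNat]
    field_simp
    ring

theorem summable_poch_descFactorial_quadWeight (a : ℂ) {c : ℂ} (hc : NotNonposInt c) {x : ℂ}
    (hx : ‖x‖ ≤ 1 / 3) :
    Summable fun p : ℕ × ℕ => poch a p.2 / Nat.factorial p.2 * x ^ p.2 *
      p.2.descFactorial (2 * p.1) * quadWeight c p.1 := by
  set α : ℝ := ‖a‖ + 1 with hα
  have hα0 : 0 < α := by positivity
  have hpos : ∀ n, 0 < (ascPochhammer ℝ n).eval α := fun n => ascPochhammer_pos n _ hα0
  set u : ℕ → ℕ → ℝ := fun k n => (ascPochhammer ℝ n).eval α / Nat.factorial n * (1 / 3) ^ n *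
    n.descFactorial (2 * k) with hu
  have hu0 : ∀ k n, 0 ≤ u k n := fun k n => by have := hpos n; positivity
  have hsum : ∀ k, HasSum (u k)
      ‖poch α (2 * k) * (1 - 1 / 3) ^ (-α : ℂ) * ((1 / 3) / (1 - 1 / 3)) ^ (2 * k)‖ := by
    intro k
    have h := hasSum_poch_descFactorial α (x := 1 / 3) (by norm_num) (2 * k)
    have h' : HasSum (fun n => ((u k n : ℝ) : ℂ))
        (poch α (2 * k) * (1 - 1 / 3) ^ (-α : ℂ) * ((1 / 3) / (1 - 1 / 3)) ^ (2 * k)) := by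
      convert h using 2 with n
      rw [poch_ofReal]
      simp [hu]
    have hs : Summable (u k) := Complex.summable_ofReal.mp h'.summable
    rw [← h'.tsum_eq, ← Complex.ofReal_tsum, Complex.norm_real,
      Real.norm_of_nonneg (tsum_nonneg (hu0 k))]
    exact hs.hasSum
  clear_value u
  have hbound : Summable fun p : ℕ × ℕ => u p.1 p.2 * ‖quadWeight c p.1‖ := by
    have hnn : 0 ≤ fun p : ℕ × ℕ => u p.1 p.2 * ‖quadWeight c p.1‖ :=
      Pi.le_def.mpr fun p => mul_nonneg (hu0 p.1 p.2) (norm_nonneg _)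
    rw [summable_prod_of_nonneg hnn]
    refine ⟨fun k => Summable.mul_right ‖quadWeight c k‖ (hsum k).summable, ?_⟩
    refine ((summable_poch_two_mul_quadWeight hα0 hc).mul_left
      ((1 - 1 / 3 : ℂ) ^ (-α : ℂ))).norm.congr fun k => ?_
    rw [((hsum k).mul_right ‖quadWeight c k‖).tsum_eq, ← norm_mul,
      show (1 / 3 : ℂ) / (1 - 1 / 3) = 1 / 2 by norm_num]
    congr 1
    ring
  refine hbound.of_norm_bounded fun p => ?_
  rw [norm_mul, norm_mul, norm_mul, norm_div, norm_pow, Complex.norm_natCast, Complex.norm_natCast]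
  simp only [hu]
  have := hpos p.2
  have := norm_poch_le a p.2
  gcongr

theorem quadratic_transform (a b : ℂ) (h2b : NotNonposInt (2 * b))
    (hb : NotNonposInt (b + 1 / 2)) (x : ℝ) (hx : |x| < 1 / 3) :
    twoF1 a b (2 * b) (2 * x) =
      ((1 : ℂ) - x) ^ (-a) *
        twoF1 (a / 2) ((a + 1) / 2) (b + 1 / 2) (((x : ℂ) / (1 - (x : ℂ))) ^ (2 : ℕ)) := by
  have hxn : ‖(x : ℂ)‖ < 1 / 3 := by simpa using hx
  have hs := summable_poch_descFactorial_quadWeight a hb hxn.le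
  have hcomm := Summable.tsum_comm (f := fun k n : ℕ => poch a n / Nat.factorial n * (x : ℂ) ^ n *
      n.descFactorial (2 * k) * quadWeight (b + 1 / 2) k) hs
  have hL : ∀ n : ℕ, ∑' k : ℕ, poch a n / Nat.factorial n * (x : ℂ) ^ n *
      n.descFactorial (2 * k) * quadWeight (b + 1 / 2) k =
      poch a n * poch b n / (poch (2 * b) n * Nat.factorial n) * (2 * x) ^ n := by
    intro n
    simp_rw [mul_assoc (poch a n / Nat.factorial n * (x : ℂ) ^ n)]
    rw [((hasSum_descFactorial_quadWeight h2b hb n).mul_left _).tsum_eq, mul_pow]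
    ring
  have hR : ∀ k : ℕ, ∑' n : ℕ, poch a n / Nat.factorial n * (x : ℂ) ^ n *
      n.descFactorial (2 * k) * quadWeight (b + 1 / 2) k =
      (1 - x : ℂ) ^ (-a) * (poch (a / 2) k * poch ((a + 1) / 2) k /
        (poch (b + 1 / 2) k * Nat.factorial k) * ((x / (1 - x) : ℂ) ^ 2) ^ k) := by
    intro k
    rw [((hasSum_poch_descFactorial a (hxn.trans (by norm_num)) (2 * k)).mul_right _).tsum_eq,
      poch_two_mul, quadWeight, pow_mul]
    have := hb.poch_ne_zero k
    have : (Nat.factorial k : ℂ) ≠ 0 := by exact_mod_cast k.factorial_ne_zero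
    field_simp
  simp_rw [hL, hR] at hcomm
  rw [twoF1, twoF1, ← tsum_mul_left]
  exact hcomm
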